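/- Let P be a frame polyomino. Then the initial ideal in_<(I_P) is generated by the monomials x_c x_d where c,d run over the pairs of anti-diagonal corners of the inner intervals [a,b] of P. -/

import Mathlib

noncomputable section

open scoped BigOperators

/-! ## Polyominoes -/

/-- Two cells of `ℤ²` (identified with their lower left corners) share an edge. -/
def cellAdj (c d : ℤ × ℤ) : Prop :=
  (c.1 = d.1 ∧ (d.2 = c.2 + 1 ∨ c.2 = d.2 + 1)) ∨
  (c.2 = d.2 ∧ (d.1 = c.1 + 1 ∨ c.1 = d.1 + 1))

/-- A polyomino: a nonempty finite collection of cells of `ℤ²` any two of which are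
connected by a path of cells of the collection in which consecutive cells share an edge. -/
structure Polyomino : Type where
  cells : Finset (ℤ × ℤ)
  nonempty : cells.Nonempty
  connected : ∀ c ∈ cells, ∀ d ∈ cells,
    Relation.ReflTransGen (fun u v => u ∈ cells ∧ v ∈ cells ∧ cellAdj u v) c d

/-- The four vertices of the cell with lower left corner `c`. -/
def cellVertices (c : ℤ × ℤ) : Finset (ℤ × ℤ) :=
  {c, (c.1 + 1, c.2), (c.1, c.2 + 1), (c.1 + 1, c.2 + 1)}

/-- The vertex set `V(P)` of a polyomino. -/
def Polyomino.vertexSet (P : Polyomino) : Finset (ℤ × ℤ) :=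
  P.cells.biUnion cellVertices

/-- The rank of `P`: the number of its cells. -/
def Polyomino.rank (P : Polyomino) : ℕ := P.cells.card

/-- The cell with lower left corner `c` is contained in the interval `[a, b]` of `ℤ²`. -/
def cellInInterval (a b c : ℤ × ℤ) : Prop :=
  a.1 ≤ c.1 ∧ c.1 + 1 ≤ b.1 ∧ a.2 ≤ c.2 ∧ c.2 + 1 ≤ b.2

/-- `[a, b]` is an inner interval of the polyomino `P`: it is a proper interval all of whose
cells belong to `P`. -/
def IsInnerInterval (P : Polyomino) (a b : ℤ × ℤ) : Prop :=
  a.1 < b.1 ∧ a.2 < b.2 ∧ ∀ c : ℤ × ℤ, cellInInterval a b c → c ∈ P.cells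

/-! ## North-east paths, parallelogram and frame polyominoes -/

/-- A north-east path: consecutive points form east or north steps. -/
def IsNEPath (L : List (ℤ × ℤ)) : Prop :=
  L ≠ [] ∧ L.Chain' (fun u v => v = (u.1 + 1, u.2) ∨ v = (u.1, u.2 + 1))

/-- The path `L` contains the east step from `(x, h)` to `(x + 1, h)`. -/
def eastStepOf (L : List (ℤ × ℤ)) (x h : ℤ) : Prop :=
  ((x, h), (x + 1, h)) ∈ L.zip L.tail

/-- The cell with lower left corner `c` lies (strictly) below the north-east path `L`. -/
def cellBelowPath (L : List (ℤ × ℤ)) (c : ℤ × ℤ) : Prop :=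
  ∃ h, eastStepOf L c.1 h ∧ c.2 < h

/-- The cell with lower left corner `c` lies (weakly) above the north-east path `L`. -/
def cellAbovePath (L : List (ℤ × ℤ)) (c : ℤ × ℤ) : Prop :=
  ∃ h, eastStepOf L c.1 h ∧ h ≤ c.2

/-- The interior points of a path (all points except the two endpoints). -/
def interiorPts (L : List (ℤ × ℤ)) : List (ℤ × ℤ) := (L.drop 1).dropLast

/-- `S1` lies above `S2`. -/
def LiesAbove (S1 S2 : List (ℤ × ℤ)) : Prop :=
  ∀ p ∈ interiorPts S1, ∀ q ∈ interiorPts S2, p.1 = q.1 → q.2 < p.2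

/-- The combinatorial data of a pair of north-east paths with the same endpoints,
the first lying above the second. -/
structure ParallelogramOn (S1 S2 : List (ℤ × ℤ)) : Prop where
  ne1 : IsNEPath S1
  ne2 : IsNEPath S2
  headEq : S1.head? = S2.head?
  lastEq : S1.getLast? = S2.getLast?
  above : LiesAbove S1 S2

/-- The cells of the region bounded above by `S1` and below by `S2`. -/
def parCells (S1 S2 : List (ℤ × ℤ)) : Set (ℤ × ℤ) :=
  {c | cellBelowPath S1 c ∧ cellAbovePath S2 c}

/-- `P` is a parallelogram polyomino. -/
def IsParallelogram (P : Polyomino) : Prop :=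
  ∃ S1 S2 : List (ℤ × ℤ), ParallelogramOn S1 S2 ∧
    (↑P.cells : Set (ℤ × ℤ)) = parCells S1 S2

/-- The data defining a frame polyomino: a rectangle `[(1,1),(m,n)]` and a parallelogram
polyomino determined by `S1, S2` with endpoints `(a0, b0)` and `(ak, bk)`. -/
structure FrameData : Type where
  m : ℤ
  n : ℤ
  S1 : List (ℤ × ℤ)
  S2 : List (ℤ × ℤ)
  a0 : ℤ
  b0 : ℤ
  ak : ℤ
  bk : ℤ
  par : ParallelogramOn S1 S2
  head1 : S1.head? = some (a0, b0)
  last1 : S1.getLast? = some (ak, bk)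
  ha0 : 1 < a0
  hak : a0 < ak
  ham : ak < m
  hb0 : 1 < b0
  hbk : b0 < bk
  hbn : bk < n

/-- The cells of the hole of a frame polyomino. -/
def FrameData.holeCells (D : FrameData) : Set (ℤ × ℤ) := parCells D.S1 D.S2

/-- The cells of the ambient rectangle `[(1,1),(m,n)]`. -/
def FrameData.rectCells (D : FrameData) : Set (ℤ × ℤ) :=
  {c | 1 ≤ c.1 ∧ c.1 + 1 ≤ D.m ∧ 1 ≤ c.2 ∧ c.2 + 1 ≤ D.n}

/-- `P` is the frame polyomino determined by the data `D`. -/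
def IsFrame (P : Polyomino) (D : FrameData) : Prop :=
  (↑P.cells : Set (ℤ × ℤ)) = D.rectCells \ D.holeCells

/-! ## The polyomino ideal -/

/-- The order on the variables: `x_(i,j) > x_(k,l)` iff `j > l`, or `j = l` and `i > k`.
`varlt u v` says that the variable `x_u` is smaller than `x_v`. -/
def varlt (u v : ℤ × ℤ) : Prop := u.2 < v.2 ∨ (u.2 = v.2 ∧ u.1 < v.1)

/-- The vertices of `P`, as a type. -/
abbrev PVertex (P : Polyomino) : Type := {v : ℤ × ℤ // v ∈ P.vertexSet}

/-- The polynomial ring `S_P = K[x_v : v ∈ V(P)]`. -/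
abbrev PolyRing (K : Type) [Field K] (P : Polyomino) : Type := MvPolynomial (PVertex P) K

/-- The set of inner 2-minors of `P`. -/
def innerMinors (K : Type) [Field K] (P : Polyomino) : Set (PolyRing K P) :=
  { f | ∃ a b c d : PVertex P,
      IsInnerInterval P a.1 b.1 ∧ c.1 = (a.1.1, b.1.2) ∧ d.1 = (b.1.1, a.1.2) ∧
      f = MvPolynomial.X a * MvPolynomial.X b - MvPolynomial.X c * MvPolynomial.X d }

/-- The polyomino ideal `I_P`. -/
def polyIdeal (K : Type) [Field K] (P : Polyomino) : Ideal (PolyRing K P) :=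
  Ideal.span (innerMinors K P)

/-- The coordinate ring `K[P] = S_P / I_P`. -/
abbrev CoordRing (K : Type) [Field K] (P : Polyomino) : Type :=
  PolyRing K P ⧸ polyIdeal K P

/-! ## Monomial orders, initial ideals and Gröbner bases -/

/-- The (degree) reverse lexicographic order on monomials induced by the
variable order `vlt`: first compare total degrees; for equal total degrees,
`m₁ < m₂` iff the smallest variable whose exponents differ has a larger exponent in `m₁`. -/
def revlexLT {α : Type} (vlt : α → α → Prop) (m₁ m₂ : α →₀ ℕ) : Prop :=
  (m₁.sum fun _ e => e) < (m₂.sum fun _ e => e) ∨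
  ((m₁.sum fun _ e => e) = (m₂.sum fun _ e => e) ∧
    ∃ v, m₂ v < m₁ v ∧ ∀ w, vlt w v → m₁ w = m₂ w)

/-- The monomial order `<` on `S_P`. -/
def pmonLT (P : Polyomino) : (PVertex P →₀ ℕ) → (PVertex P →₀ ℕ) → Prop :=
  revlexLT fun u v => varlt u.1 v.1

/-- `m` is the leading monomial of `f` with respect to the monomial order `lt`. -/
def IsLeadMon {α K : Type} [CommSemiring K] (lt : (α →₀ ℕ) → (α →₀ ℕ) → Prop)
    (f : MvPolynomial α K) (m : α →₀ ℕ) : Prop :=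
  m ∈ f.support ∧ ∀ m' ∈ f.support, m' ≠ m → lt m' m

/-- The initial ideal of `I` with respect to the monomial order `lt`: the ideal generated by
the leading monomials of the nonzero elements of `I`. -/
def initialIdeal {α K : Type} [CommSemiring K] (lt : (α →₀ ℕ) → (α →₀ ℕ) → Prop)
    (I : Ideal (MvPolynomial α K)) : Ideal (MvPolynomial α K) :=
  Ideal.span { g | ∃ f ∈ I, f ≠ 0 ∧ ∃ m, IsLeadMon lt f m ∧ g = MvPolynomial.monomial m 1 }

/-- The initial ideal `in_<(I_P)`. -/
def inIdeal (K : Type) [Field K] (P : Polyomino) : Ideal (PolyRing K P) :=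
  initialIdeal (pmonLT P) (polyIdeal K P)

/-- `G` is a Gröbner basis of `I` with respect to `lt`. -/
def IsGroebnerBasis {α K : Type} [CommSemiring K] (lt : (α →₀ ℕ) → (α →₀ ℕ) → Prop)
    (G : Set (MvPolynomial α K)) (I : Ideal (MvPolynomial α K)) : Prop :=
  G ⊆ (I : Set (MvPolynomial α K)) ∧
  initialIdeal lt I =
    Ideal.span { g | ∃ f ∈ G, ∃ m, IsLeadMon lt f m ∧ g = MvPolynomial.monomial m 1 }

/-- `G` is the reduced Gröbner basis of `I` with respect to `lt`: it is a Gröbner basis,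
each element is monic, and no monomial occurring in an element of `G` is divisible by the
leading monomial of a different element of `G`. -/
def IsReducedGroebnerBasis {α K : Type} [CommSemiring K] (lt : (α →₀ ℕ) → (α →₀ ℕ) → Prop)
    (G : Set (MvPolynomial α K)) (I : Ideal (MvPolynomial α K)) : Prop :=
  IsGroebnerBasis lt G I ∧
  (∀ f ∈ G, ∃ m, IsLeadMon lt f m ∧ MvPolynomial.coeff m f = 1) ∧
  (∀ f ∈ G, ∀ m ∈ (f : MvPolynomial α K).support, ∀ f' ∈ G, f' ≠ f →
    ∀ m', IsLeadMon lt f' m' → ¬ m' ≤ m)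

/-! ## The simplicial complex Δ(P) -/

/-- The squarefree exponent vector supported on `W ∩ V(P)`. -/
def expOf (P : Polyomino) (W : Finset (ℤ × ℤ)) : PVertex P →₀ ℕ :=
  ∑ v ∈ P.vertexSet.attach, if v.1 ∈ W then Finsupp.single v 1 else 0

/-- `W` is a face of the simplicial complex `Δ(P)` whose Stanley–Reisner ideal is
`in_<(I_P)`: `W ⊆ V(P)` and the product of the variables indexed by `W` is not in
`in_<(I_P)`. -/
def IsFace (K : Type) [Field K] (P : Polyomino) (W : Finset (ℤ × ℤ)) : Prop :=
  (↑W : Set (ℤ × ℤ)) ⊆ (↑P.vertexSet : Set (ℤ × ℤ)) ∧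
  MvPolynomial.monomial (expOf P W) (1 : K) ∉ inIdeal K P

/-- `W` is a facet (maximal face) of `Δ(P)`. -/
def IsFacet (K : Type) [Field K] (P : Polyomino) (W : Finset (ℤ × ℤ)) : Prop :=
  IsFace K P W ∧ ∀ W' : Finset (ℤ × ℤ), IsFace K P W' → W ⊆ W' → W = W'

/-- `{p, q, r}` is a step of the face `W`, with lower right corner `q`. -/
def IsStep (P : Polyomino) (W : Finset (ℤ × ℤ)) (p q r : ℤ × ℤ) : Prop :=
  p ∈ W ∧ q ∈ W ∧ r ∈ W ∧
  p.2 = q.2 ∧ q.1 = r.1 ∧ p.1 < q.1 ∧ q.2 < r.2 ∧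
  (∀ w ∈ W, w.2 = p.2 → p.1 < w.1 → w.1 < q.1 → False) ∧
  (∀ w ∈ W, w.1 = q.1 → q.2 < w.2 → w.2 < r.2 → False) ∧
  (q.1 - 1, q.2) ∈ P.cells

/-- The number of steps of a face `W`. -/
def stepCount (P : Polyomino) (W : Finset (ℤ × ℤ)) : ℕ :=
  Set.ncard { t : (ℤ × ℤ) × (ℤ × ℤ) × (ℤ × ℤ) | IsStep P W t.1 t.2.1 t.2.2 }

/-- The simplicial complex generated by a collection of subsets. -/
def genComplex (F : Set (Finset (ℤ × ℤ))) : Set (Finset (ℤ × ℤ)) :=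
  { W | ∃ G ∈ F, W ⊆ G }

/-- The lexicographic order on facets: `flexLT F G` iff, listing the elements of `F` and `G`
in decreasing order with respect to the total order on `V(P)`, at the first position where
the lists differ the element of `F` is greater.  Equivalently, the largest element of the
symmetric difference belongs to `F`. -/
def flexLT (F G : Finset (ℤ × ℤ)) : Prop :=
  ∃ v, v ∈ F ∧ v ∉ G ∧ ∀ w, varlt v w → (w ∈ F ↔ w ∈ G)

/-- The facet `F₀` of `Δ(P)`. -/
def FrameData.F0 (D : FrameData) : Finset (ℤ × ℤ) :=
  Finset.Icc ((1 : ℤ), (1 : ℤ)) (1, D.n) ∪ Finset.Icc ((1 : ℤ), D.n) (D.m, D.n) ∪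
    (D.S2.toFinset \ {(D.a0, D.b0), (D.ak, D.bk)})

/-! ## Edge intervals -/

/-- The horizontal unit edge from `(x, y)` to `(x + 1, y)` is an edge of a cell of `P`. -/
def hEdge (P : Polyomino) (x y : ℤ) : Prop :=
  (x, y) ∈ P.cells ∨ (x, y - 1) ∈ P.cells

/-- The vertical unit edge from `(x, y)` to `(x, y + 1)` is an edge of a cell of `P`. -/
def vEdge (P : Polyomino) (x y : ℤ) : Prop :=
  (x, y) ∈ P.cells ∨ (x - 1, y) ∈ P.cells

/-- `[(i, j), (k, j)]` is a maximal horizontal edge interval of `P`. -/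
def IsMaxHEdgeInterval (P : Polyomino) (i k j : ℤ) : Prop :=
  i < k ∧ (∀ l, i ≤ l → l < k → hEdge P l j) ∧ ¬ hEdge P (i - 1) j ∧ ¬ hEdge P k j

/-- `[(x, j), (x, l)]` is a maximal vertical edge interval of `P`. -/
def IsMaxVEdgeInterval (P : Polyomino) (x j l : ℤ) : Prop :=
  j < l ∧ (∀ y, j ≤ y → y < l → vEdge P x y) ∧ ¬ vEdge P x (j - 1) ∧ ¬ vEdge P x l

/-- The vertex set of the collection of cells of `P` contained in the interval `[a, b]`. -/
def boxVertexSet (P : Polyomino) (a b : ℤ × ℤ) : Set (ℤ × ℤ) :=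
  { v | ∃ c ∈ P.cells, cellInInterval a b c ∧ v ∈ cellVertices c }

/-! ## Rook configurations -/

/-- Two (distinct) cells of `P` are in attacking position: they belong to the same row or
the same column of cells of `P`. -/
def attacking (P : Polyomino) (c d : ℤ × ℤ) : Prop :=
  c ≠ d ∧
  ((c.2 = d.2 ∧ ∀ x, min c.1 d.1 ≤ x → x ≤ max c.1 d.1 → (x, c.2) ∈ P.cells) ∨
   (c.1 = d.1 ∧ ∀ y, min c.2 d.2 ≤ y → y ≤ max c.2 d.2 → (c.1, y) ∈ P.cells))

/-- `R` is a configuration of pairwise non-attacking rooks placed on cells of `P`. -/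
def IsRookConfig (P : Polyomino) (R : Finset (ℤ × ℤ)) : Prop :=
  (↑R : Set (ℤ × ℤ)) ⊆ (↑P.cells : Set (ℤ × ℤ)) ∧ ∀ c ∈ R, ∀ d ∈ R, ¬ attacking P c d

/-- Two cells are the diagonal cells of an inner interval of `P`. -/
def diagPair (P : Polyomino) (c d : ℤ × ℤ) : Prop :=
  ∃ a b : ℤ × ℤ, IsInnerInterval P a b ∧
    ((c = a ∧ d = (b.1 - 1, b.2 - 1)) ∨ (d = a ∧ c = (b.1 - 1, b.2 - 1)))

/-- Two cells are the anti-diagonal cells of an inner interval of `P`. -/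
def antiDiagPair (P : Polyomino) (c d : ℤ × ℤ) : Prop :=
  ∃ a b : ℤ × ℤ, IsInnerInterval P a b ∧
    ((c = (a.1, b.2 - 1) ∧ d = (b.1 - 1, a.2)) ∨ (d = (a.1, b.2 - 1) ∧ c = (b.1 - 1, a.2)))

/-- One switch: replace two rooks placed on the diagonal cells of an inner interval by rooks
on its anti-diagonal cells, or vice versa. -/
def switchStep (P : Polyomino) (R R' : Finset (ℤ × ℤ)) : Prop :=
  ∃ a b : ℤ × ℤ, IsInnerInterval P a b ∧
    ((a ∈ R ∧ (b.1 - 1, b.2 - 1) ∈ R ∧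
      R' = insert (a.1, b.2 - 1) (insert (b.1 - 1, a.2)
        ((R.erase a).erase (b.1 - 1, b.2 - 1)))) ∨
     ((a.1, b.2 - 1) ∈ R ∧ (b.1 - 1, a.2) ∈ R ∧
      R' = insert a (insert (b.1 - 1, b.2 - 1)
        ((R.erase (a.1, b.2 - 1)).erase (b.1 - 1, a.2)))))

/-- A canonical configuration: no two rooks are in anti-diagonal position. -/
def IsCanonical (P : Polyomino) (R : Finset (ℤ × ℤ)) : Prop :=
  ∀ c ∈ R, ∀ d ∈ R, ¬ antiDiagPair P c d

/-- The `k`-rook configurations of `P`, as a type. -/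
def RookConfigType (P : Polyomino) (k : ℕ) : Type :=
  { R : Finset (ℤ × ℤ) // IsRookConfig P R ∧ R.card = k }

/-- `r̃_k`: the number of equivalence classes of `k`-rook configurations of `P` under the
equivalence generated by switches. -/
def rtil (P : Polyomino) (k : ℕ) : ℕ :=
  Nat.card (Quot fun R S : RookConfigType P k => switchStep P R.1 S.1)

/-- The rook number of `P`: the maximum number of pairwise non-attacking rooks in `P`. -/
def rookNumber (P : Polyomino) : ℕ :=
  sSup { k | ∃ R : Finset (ℤ × ℤ), IsRookConfig P R ∧ R.card = k }

/-! ## Hilbert functions -/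

/-- The Hilbert function of the standard graded algebra `K[P]`. -/
def hilbertFunction (K : Type) [Field K] (P : Polyomino) (k : ℕ) : ℕ :=
  Module.finrank K
    (Submodule.map (Ideal.Quotient.mkₐ K (polyIdeal K P)).toLinearMap
      (MvPolynomial.homogeneousSubmodule (PVertex P) K k))

/-- The Hilbert–Poincaré series of `K[P]`, as a power series over `ℤ`. -/
def hilbertSeries (K : Type) [Field K] (P : Polyomino) : PowerSeries ℤ :=
  PowerSeries.mk fun k => (hilbertFunction K P k : ℤ)

set_option synthInstance.maxHeartbeats 1000000 in
/-- `K[P]` is Cohen–Macaulay: there exists a regular sequence, consisting of elements of the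
irrelevant maximal ideal, whose length equals the Krull dimension of `K[P]`. -/
def IsCMCoordRing (K : Type) [Field K] (P : Polyomino) : Prop :=
  ∃ rs : List (CoordRing K P),
    RingTheory.Sequence.IsRegular (CoordRing K P) rs ∧
    (∀ r ∈ rs, r ∈ Ideal.map (Ideal.Quotient.mk (polyIdeal K P))
      (Ideal.span (Set.range (MvPolynomial.X : PVertex P → PolyRing K P)))) ∧
    (rs.length : WithBot (WithTop ℕ)) = ringKrullDim (CoordRing K P)

/-! ## Maximal chains and descents (for parallelogram polyominoes) -/

/-- `C` is a maximal chain of the poset `V(P)` (with the componentwise order). -/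
def IsMaximalChainOn (P : Polyomino) (C : Finset (ℤ × ℤ)) : Prop :=
  (↑C : Set (ℤ × ℤ)) ⊆ (↑P.vertexSet : Set (ℤ × ℤ)) ∧
  IsChain (· ≤ ·) (↑C : Set (ℤ × ℤ)) ∧
  ∀ C' : Finset (ℤ × ℤ), (↑C' : Set (ℤ × ℤ)) ⊆ (↑P.vertexSet : Set (ℤ × ℤ)) →
    IsChain (· ≤ ·) (↑C' : Set (ℤ × ℤ)) → C ⊆ C' → C = C'

/-- The chain `C` has a descent at the cell of `P` with lower left corner `c`. -/
def descentAt (P : Polyomino) (C : Finset (ℤ × ℤ)) (c : ℤ × ℤ) : Prop :=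
  c ∈ P.cells ∧ c ∈ C ∧ (c.1 + 1, c.2) ∈ C ∧ (c.1 + 1, c.2 + 1) ∈ C

/-- The number of descents of the chain `C`. -/
def descentCount (P : Polyomino) (C : Finset (ℤ × ℤ)) : ℕ :=
  Set.ncard { c : ℤ × ℤ | descentAt P C c }

/-! ## Minimal graded free resolutions and Castelnuovo–Mumford regularity -/

/-- A finite minimal graded free resolution of `S_P / I` over `S_P`:
`F_d = ⊕_{i} S_P(-tw d i)` with `F_0 = S_P`, differentials given by matrices of homogeneous
polynomials of the appropriate degrees with entries in the irrelevant maximal ideal,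
exact away from homological degree `0` and with image `I` in homological degree `0`. -/
structure MinimalGradedFreeResolution (K : Type) [Field K] (P : Polyomino)
    (I : Ideal (PolyRing K P)) : Type where
  len : ℕ
  t : ℕ → ℕ
  tw : (d : ℕ) → Fin (t d) → ℤ
  mat : (d : ℕ) → Matrix (Fin (t d)) (Fin (t (d + 1))) (PolyRing K P)
  t0 : t 0 = 1
  tw0 : ∀ i, tw 0 i = 0
  finite : ∀ d, len < d → t d = 0
  graded : ∀ d i j, mat d i j = 0 ∨
    ∃ e : ℕ, (e : ℤ) = tw (d + 1) j - tw d i ∧ (mat d i j).IsHomogeneous e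
  minimal : ∀ d i j, MvPolynomial.coeff 0 (mat d i j) = 0
  aug : LinearMap.range (mat 0).mulVecLin =
    Submodule.pi Set.univ (fun _ : Fin (t 0) => I)
  isexact : ∀ d, LinearMap.range (mat (d + 1)).mulVecLin = LinearMap.ker (mat d).mulVecLin

end


/-! ### Rewriting on monomials -/

/-- Exponent vector of the variable at a lattice point (zero outside `V(P)`). -/
noncomputable def FIe (P : Polyomino) (v : ℤ × ℤ) : PVertex P →₀ ℕ :=
  if h : v ∈ P.vertexSet then Finsupp.single ⟨v, h⟩ 1 else 0

/-- Coordinate version of inner intervals. -/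
def FIInn (P : Polyomino) (x1 x2 y1 y2 : ℤ) : Prop :=
  x1 < x2 ∧ y1 < y2 ∧ ∀ x y, x1 ≤ x → x < x2 → y1 ≤ y → y < y2 → (x, y) ∈ P.cells

/-- One rewriting step. -/
def FIStep (P : Polyomino) (m m' : PVertex P →₀ ℕ) : Prop :=
  ∃ x1 x2 y1 y2 s, FIInn P x1 x2 y1 y2 ∧ m = FIe P (x1, y2) + FIe P (x2, y1) + s ∧
    m' = FIe P (x1, y1) + FIe P (x2, y2) + s

theorem FIe_of {P : Polyomino} (v : PVertex P) : FIe P v.1 = Finsupp.single v 1 := by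
  simp [FIe, v.2]

theorem FIe_apply {P : Polyomino} (v : ℤ × ℤ) (w : PVertex P) :
    FIe P v w = if v = w.1 then 1 else 0 := by
  classical
  unfold FIe
  split_ifs with h1 h2 h2
  · subst h2; simp
  · rw [Finsupp.single_apply, if_neg]
    intro h; exact h2 (by rw [← h])
  · exact absurd (h2 ▸ w.2) h1
  · rfl

theorem FImem {P : Polyomino} {c v : ℤ × ℤ} (hc : c ∈ P.cells) (hv : v ∈ cellVertices c) :
    v ∈ P.vertexSet := by
  unfold Polyomino.vertexSet
  exact Finset.mem_biUnion.2 ⟨c, hc, hv⟩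

theorem FIInn.corners {P : Polyomino} {x1 x2 y1 y2 : ℤ} (h : FIInn P x1 x2 y1 y2) :
    (x1, y1) ∈ P.vertexSet ∧ (x2, y2) ∈ P.vertexSet ∧ (x1, y2) ∈ P.vertexSet ∧
      (x2, y1) ∈ P.vertexSet := by
  obtain ⟨hx, hy, hc⟩ := h
  refine ⟨FImem (hc x1 y1 ?_ ?_ ?_ ?_) ?_, FImem (hc (x2 - 1) (y2 - 1) ?_ ?_ ?_ ?_) ?_,
    FImem (hc x1 (y2 - 1) ?_ ?_ ?_ ?_) ?_, FImem (hc (x2 - 1) y1 ?_ ?_ ?_ ?_) ?_⟩ <;>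
    first | omega | simp [cellVertices]

theorem FIInn.sub {P : Polyomino} {x1 x2 y1 y2 u1 u2 v1 v2 : ℤ} (h : FIInn P x1 x2 y1 y2)
    (h1 : x1 ≤ u1) (h2 : u1 < u2) (h3 : u2 ≤ x2) (h4 : y1 ≤ v1) (h5 : v1 < v2) (h6 : v2 ≤ y2) :
    FIInn P u1 u2 v1 v2 :=
  ⟨h2, h5, fun x y a b c d => h.2.2 x y (by omega) (by omega) (by omega) (by omega)⟩

theorem FIInn.hglue {P : Polyomino} {x1 x2 x3 y1 y2 : ℤ} (h : FIInn P x1 x2 y1 y2)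
    (h' : FIInn P x2 x3 y1 y2) : FIInn P x1 x3 y1 y2 := by
  refine ⟨by have := h.1; have := h'.1; omega, h.2.1, fun x y a b c d => ?_⟩
  by_cases hx : x < x2
  · exact h.2.2 x y a hx c d
  · exact h'.2.2 x y (by omega) b c d

theorem FIInn.vglue {P : Polyomino} {x1 x2 y1 y2 y3 : ℤ} (h : FIInn P x1 x2 y1 y2)
    (h' : FIInn P x1 x2 y2 y3) : FIInn P x1 x2 y1 y3 := by
  refine ⟨h.1, by have := h.2.1; have := h'.2.1; omega, fun x y a b c d => ?_⟩
  by_cases hx : y < y2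
  · exact h.2.2 x y a b c hx
  · exact h'.2.2 x y a b (by omega) d

theorem FIInn_iff {P : Polyomino} (a b : ℤ × ℤ) :
    IsInnerInterval P a b ↔ FIInn P a.1 b.1 a.2 b.2 := by
  constructor
  · rintro ⟨h1, h2, h3⟩
    exact ⟨h1, h2, fun x y p q r s => h3 (x, y) ⟨p, by show x + 1 ≤ _; omega, r, by show y + 1 ≤ _; omega⟩⟩
  · rintro ⟨h1, h2, h3⟩
    refine ⟨h1, h2, fun c hc => ?_⟩
    obtain ⟨p, q, r, s⟩ := hc
    exact h3 c.1 c.2 p (by omega) r (by omega)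

theorem FIe_split {P : Polyomino} {v w : ℤ × ℤ} (_hv : v ∈ P.vertexSet) (hw : w ∈ P.vertexSet)
    {s t : PVertex P →₀ ℕ} (h : FIe P v + s = FIe P w + t) :
    (v = w ∧ s = t) ∨ (v ≠ w ∧ ∃ u, s = FIe P w + u ∧ t = FIe P v + u) := by
  by_cases hvw : v = w
  · subst hvw; exact Or.inl ⟨rfl, add_left_cancel h⟩
  · right
    have hle : FIe P w ≤ s := by
      intro z
      have := DFunLike.congr_fun h z
      simp only [Finsupp.add_apply, FIe_apply] at this ⊢
      split_ifs at this ⊢ with h1 h2 <;> first | omega | (exfalso; exact hvw (by simp_all))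
    obtain ⟨u, rfl⟩ := exists_add_of_le hle
    refine ⟨hvw, u, rfl, ?_⟩
    have : FIe P w + (FIe P v + u) = FIe P w + t := by rw [← h]; abel
    exact (add_left_cancel this).symm

/-- The combinatorial condition on `P`. -/
def FIGood (P : Polyomino) : Prop :=
  ∀ x1 x2 x3 y1 y2 y3, FIInn P x1 x2 y2 y3 → FIInn P x2 x3 y1 y2 →
    FIInn P x2 x3 y2 y3 ∨ FIInn P x1 x2 y1 y2

abbrev FIJoin (P : Polyomino) (m m' : PVertex P →₀ ℕ) : Prop :=
  ∃ w, Relation.ReflTransGen (FIStep P) m w ∧ Relation.ReflTransGen (FIStep P) m' w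

theorem FIJoin.symm {P : Polyomino} {m m' : PVertex P →₀ ℕ} (h : FIJoin P m m') :
    FIJoin P m' m := by
  obtain ⟨w, a, b⟩ := h; exact ⟨w, b, a⟩

theorem FIone {P : Polyomino} {x1 x2 y1 y2 : ℤ} (h : FIInn P x1 x2 y1 y2)
    (s : PVertex P →₀ ℕ) {m m' : PVertex P →₀ ℕ}
    (hm : m = FIe P (x1, y2) + FIe P (x2, y1) + s)
    (hm' : m' = FIe P (x1, y1) + FIe P (x2, y2) + s) :
    Relation.ReflTransGen (FIStep P) m m' :=
  Relation.ReflTransGen.single ⟨x1, x2, y1, y2, s, h, hm, hm'⟩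

/-- Overlap in the middle. -/
theorem FIcaseA {P : Polyomino} (hG : FIGood P) {x1 x2 x3 y1 y2 y3 : ℤ}
    (h1 : FIInn P x1 x2 y2 y3) (h2 : FIInn P x2 x3 y1 y2) (u : PVertex P →₀ ℕ) :
    FIJoin P (FIe P (x1, y2) + FIe P (x2, y3) + (FIe P (x3, y1) + u))
      (FIe P (x2, y1) + FIe P (x3, y2) + (FIe P (x1, y3) + u)) := by
  rcases hG _ _ _ _ _ _ h1 h2 with h | h
  · exact ⟨FIe P (x1, y2) + FIe P (x2, y1) + FIe P (x3, y3) + u,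
      FIone (h2.vglue h) (FIe P (x1, y2) + u) (by abel) (by abel),
      FIone (h1.hglue h) (FIe P (x2, y1) + u) (by abel) (by abel)⟩
  · exact ⟨FIe P (x1, y1) + FIe P (x3, y2) + FIe P (x2, y3) + u,
      FIone (h.hglue h2) (FIe P (x2, y3) + u) (by abel) (by abel),
      FIone (h.vglue h1) (FIe P (x3, y2) + u) (by abel) (by abel)⟩

/-- Overlap in the upper left corner `(x, y)`. -/
theorem FIcaseB {P : Polyomino} {x y q1 q2 r1 r2 : ℤ} (hle : q1 ≤ r1)
    (h1 : FIInn P x q1 q2 y) (h2 : FIInn P x r1 r2 y) (u : PVertex P →₀ ℕ) :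
    FIJoin P (FIe P (x, q2) + FIe P (q1, y) + (FIe P (r1, r2) + u))
      (FIe P (x, r2) + FIe P (r1, y) + (FIe P (q1, q2) + u)) := by
  have a1 := h1.1
  have a2 := h1.2.1
  have b1 := h2.1
  have b2 := h2.2.1
  rcases hle.eq_or_lt with rfl | hlt
  · rcases lt_trichotomy q2 r2 with hl | rfl | hl
    · exact ⟨_, .refl, FIone (h1.sub le_rfl a1 le_rfl le_rfl hl b2.le)
        (FIe P (q1, y) + u) (by abel) (by abel)⟩
    · exact ⟨_, .refl, .refl⟩
    · exact ⟨_, FIone (h2.sub le_rfl a1 le_rfl le_rfl hl a2.le)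
        (FIe P (q1, y) + u) (by abel) (by abel), .refl⟩
  · rcases lt_trichotomy q2 r2 with hl | rfl | hl
    · exact ⟨FIe P (q1, r2) + FIe P (r1, y) + FIe P (x, q2) + u,
        FIone (h2.sub a1.le hlt le_rfl le_rfl b2 le_rfl) (FIe P (x, q2) + u) (by abel) (by abel),
        FIone (h1.sub le_rfl a1 le_rfl le_rfl hl b2.le) (FIe P (r1, y) + u) (by abel) (by abel)⟩
    · exact ⟨_, FIone (h2.sub a1.le hlt le_rfl le_rfl b2 le_rfl)
        (FIe P (x, q2) + u) (by abel) (by abel), .refl⟩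
    · exact ⟨_, (FIone (h2.sub a1.le hlt le_rfl le_rfl b2 le_rfl)
        (m' := FIe P (q1, r2) + FIe P (r1, y) + (FIe P (x, q2) + u))
        (FIe P (x, q2) + u) (by abel) (by abel)).trans
        (FIone (h2.sub le_rfl a1 hle le_rfl hl a2.le) (FIe P (r1, y) + u) (by abel) (by abel)),
        .refl⟩

/-- Overlap in the lower right corner `(x, y)`. -/
theorem FIcaseC {P : Polyomino} {x y q1 q2 r1 r2 : ℤ} (hle : r1 ≤ q1)
    (h1 : FIInn P q1 x y q2) (h2 : FIInn P r1 x y r2) (u : PVertex P →₀ ℕ) :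
    FIJoin P (FIe P (q1, y) + FIe P (x, q2) + (FIe P (r1, r2) + u))
      (FIe P (r1, y) + FIe P (x, r2) + (FIe P (q1, q2) + u)) := by
  have a1 := h1.1
  have a2 := h1.2.1
  have b1 := h2.1
  have b2 := h2.2.1
  rcases hle.eq_or_lt with rfl | hlt
  · rcases lt_trichotomy q2 r2 with hl | rfl | hl
    · exact ⟨_, FIone (h2.sub le_rfl a1 le_rfl a2.le hl le_rfl)
        (FIe P (r1, y) + u) (by abel) (by abel), .refl⟩
    · exact ⟨_, .refl, .refl⟩
    · exact ⟨_, .refl, FIone (h1.sub le_rfl a1 le_rfl b2.le hl le_rfl)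
        (FIe P (r1, y) + u) (by abel) (by abel)⟩
  · rcases lt_trichotomy q2 r2 with hl | rfl | hl
    · exact ⟨_, (FIone (h2.sub le_rfl hlt a1.le le_rfl b2 le_rfl)
        (m' := FIe P (r1, y) + FIe P (q1, r2) + (FIe P (x, q2) + u))
        (FIe P (x, q2) + u) (by abel) (by abel)).trans
        (FIone (h2.sub hle a1 le_rfl a2.le hl le_rfl) (FIe P (r1, y) + u) (by abel) (by abel)),
        .refl⟩
    · exact ⟨_, FIone (h2.sub le_rfl hlt a1.le le_rfl b2 le_rfl)
        (FIe P (x, q2) + u) (by abel) (by abel), .refl⟩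
    · exact ⟨FIe P (r1, y) + FIe P (q1, r2) + FIe P (x, q2) + u,
        FIone (h2.sub le_rfl hlt a1.le le_rfl b2 le_rfl) (FIe P (x, q2) + u) (by abel) (by abel),
        FIone (h1.sub le_rfl a1 le_rfl b2.le hl le_rfl) (FIe P (r1, y) + u) (by abel) (by abel)⟩

theorem FIlocal {P : Polyomino} (hG : FIGood P) {m m1 m2 : PVertex P →₀ ℕ}
    (h1 : FIStep P m m1) (h2 : FIStep P m m2) : FIJoin P m1 m2 := by
  obtain ⟨x1, x2, y1, y2, s, hi, hm, rfl⟩ := h1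
  obtain ⟨u1, u2, v1, v2, t, hj, hm', rfl⟩ := h2
  obtain ⟨-, -, hc, hd⟩ := hi.corners
  obtain ⟨-, -, hc', hd'⟩ := hj.corners
  have hi1 := hi.1
  have hi2 := hi.2.1
  have hj1 := hj.1
  have hj2 := hj.2.1
  rw [hm, add_assoc, add_assoc] at hm'
  rcases FIe_split hc hc' hm' with ⟨he, hs⟩ | ⟨-, w, hw1, hw2⟩
  · rw [Prod.mk.injEq] at he
    obtain ⟨rfl, rfl⟩ := he
    rcases FIe_split hd hd' hs with ⟨he, hs'⟩ | ⟨-, w, rfl, rfl⟩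
    · rw [Prod.mk.injEq] at he
      obtain ⟨rfl, rfl⟩ := he
      subst hs'
      exact ⟨_, .refl, .refl⟩
    · rcases le_total x2 u2 with hle | hle
      · exact FIcaseB hle hi hj w
      · exact (FIcaseB hle hj hi w).symm
  · -- `c' ≠ c`
    rcases FIe_split hd hc' hw1 with ⟨he, hs⟩ | ⟨-, z, rfl, rfl⟩
    · -- `d = c'`
      rw [Prod.mk.injEq] at he
      obtain ⟨rfl, rfl⟩ := he
      subst hs
      rcases FIe_split hd' hc hw2 with ⟨he, hs⟩ | ⟨-, z, rfl, rfl⟩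
      · rw [Prod.mk.injEq] at he
        omega
      · exact FIcaseA hG hi hj z
    · -- `t + d' = c + d + z`
      rcases FIe_split hd' hc hw2 with ⟨he, hs⟩ | ⟨-, z', rfl, hz⟩
      · rw [Prod.mk.injEq] at he
        obtain ⟨rfl, rfl⟩ := he
        subst hs
        exact (FIcaseA hG hj hi z).symm
      · rcases FIe_split hd hd' hz with ⟨he, hs⟩ | ⟨-, z, rfl, rfl⟩
        · rw [Prod.mk.injEq] at he
          obtain ⟨rfl, rfl⟩ := he
          subst hs
          rcases le_total u1 x1 with hle | hle
          · exact FIcaseC hle hi hj z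
          · exact (FIcaseC hle hj hi z).symm
        · exact ⟨FIe P (x1, y1) + FIe P (x2, y2) + FIe P (u1, v1) + FIe P (u2, v2) + z,
            FIone hj (FIe P (x1, y1) + FIe P (x2, y2) + z) (by abel) (by abel),
            FIone hi (FIe P (u1, v1) + FIe P (u2, v2) + z) (by abel) (by abel)⟩

/-! ### Newman's lemma -/

theorem FInewman {A : Type} (R : A → A → Prop) (μ : A → ℕ) (hμ : ∀ a b, R a b → μ b < μ a)
    (hl : ∀ m a b, R m a → R m b →
      ∃ w, Relation.ReflTransGen R a w ∧ Relation.ReflTransGen R b w) :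
    ∃ N : A → A, (∀ a, Relation.ReflTransGen R a (N a)) ∧ (∀ a b, R a b → N a = N b) ∧
      (∀ a, (∀ b, ¬ R a b) → N a = a) := by
  have key : ∀ k, ∀ m, μ m = k → (∃ w, Relation.ReflTransGen R m w ∧ ∀ b, ¬ R w b) ∧
      ∀ w w', Relation.ReflTransGen R m w → (∀ b, ¬ R w b) →
        Relation.ReflTransGen R m w' → (∀ b, ¬ R w' b) → w = w' := by
    intro k
    induction k using Nat.strong_induction_on with
    | _ k ih =>
      intro m hm
      constructor
      · by_cases h : ∃ b, R m b
        · obtain ⟨b, hb⟩ := h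
          obtain ⟨⟨w, hw, hw'⟩, -⟩ := ih (μ b) (hm ▸ hμ _ _ hb) b rfl
          exact ⟨w, .head hb hw, hw'⟩
        · exact ⟨m, .refl, fun b hb => h ⟨b, hb⟩⟩
      · intro w w' h1 h2 h3 h4
        rcases Relation.ReflTransGen.cases_head h1 with rfl | ⟨a, ha, haw⟩
        · rcases Relation.ReflTransGen.cases_head h3 with rfl | ⟨b, hb, hbw⟩
          · rfl
          · exact absurd hb (h2 b)
        · rcases Relation.ReflTransGen.cases_head h3 with rfl | ⟨b, hb, hbw⟩
          · exact absurd ha (h4 a)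
          · obtain ⟨z, hz1, hz2⟩ := hl m a b ha hb
            have iha := ih (μ a) (hm ▸ hμ _ _ ha) a rfl
            have ihb := ih (μ b) (hm ▸ hμ _ _ hb) b rfl
            have hzv : ∃ v, Relation.ReflTransGen R z v ∧ ∀ c, ¬ R v c := by
              rcases Relation.ReflTransGen.cases_head hz1 with rfl | ⟨a', ha', haz⟩
              · exact iha.1
              · have : μ z < k := by
                  have : ∀ x y, Relation.ReflTransGen R x y → μ y ≤ μ x := by
                    intro x y hxy
                    induction hxy with
                    | refl => exact le_rfl
                    | tail _ h ih => exact (hμ _ _ h).le.trans ih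
                  have := this _ _ hz1
                  have := hμ _ _ ha
                  omega
                exact (ih _ this z rfl).1
            obtain ⟨v, hv1, hv2⟩ := hzv
            exact (iha.2 w v haw h2 (hz1.trans hv1) hv2).trans
              (ihb.2 w' v hbw h4 (hz2.trans hv1) hv2).symm
  choose N hN using fun m => (key (μ m) m rfl).1
  refine ⟨N, fun a => (hN a).1, fun a b hab => ?_, fun a ha => ?_⟩
  · exact (key _ a rfl).2 _ _ (hN a).1 (hN a).2 (.head hab (hN b).1) (hN b).2
  · exact (key _ a rfl).2 _ _ (hN a).1 (hN a).2 .refl ha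

/-! ### The monomial order -/

theorem FIlt_trans {P : Polyomino} {m1 m2 m3 : PVertex P →₀ ℕ} (h : pmonLT P m1 m2)
    (h' : pmonLT P m2 m3) : pmonLT P m1 m3 := by
  unfold pmonLT revlexLT at *
  rcases h with h | ⟨h, v, hv, hv'⟩
  · left
    rcases h' with h' | ⟨h', -⟩
    · exact h.trans h'
    · exact h' ▸ h
  · rcases h' with h' | ⟨h', w, hw, hw'⟩
    · left; exact h ▸ h'
    · right
      refine ⟨h.trans h', ?_⟩
      have htr : ∀ a b c : ℤ × ℤ, varlt a b → varlt b c → varlt a c := by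
        intro a b c; unfold varlt; omega
      have htri : varlt v.1 w.1 ∨ v = w ∨ varlt w.1 v.1 := by
        have : v = w ↔ v.1.1 = w.1.1 ∧ v.1.2 = w.1.2 := by
          rw [Subtype.ext_iff, Prod.ext_iff]
        rw [this]; unfold varlt; omega
      rcases htri with hvw | rfl | hvw
      · exact ⟨v, by rw [← hw' v hvw]; exact hv,
          fun z hz => (hv' z hz).trans (hw' z (htr _ _ _ hz hvw))⟩
      · exact ⟨v, hw.trans hv, fun z hz => (hv' z hz).trans (hw' z hz)⟩
      · exact ⟨w, by rw [hv' w hvw]; exact hw,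
          fun z hz => (hv' z (htr _ _ _ hz hvw)).trans (hw' z hz)⟩

theorem FIlt_irrefl {P : Polyomino} {m : PVertex P →₀ ℕ} : ¬ pmonLT P m m := by
  rintro (h | ⟨-, v, hv, -⟩)
  · exact lt_irrefl _ h
  · exact lt_irrefl _ hv

theorem FIdeg {P : Polyomino} (s t : PVertex P →₀ ℕ) :
    ((s + t).sum fun _ e => e) = (s.sum fun _ e => e) + (t.sum fun _ e => e) :=
  Finsupp.sum_add_index' (fun _ => rfl) (fun _ _ _ => rfl)

theorem FIdeg_e {P : Polyomino} {v : ℤ × ℤ} (hv : v ∈ P.vertexSet) :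
    ((FIe P v).sum fun _ e => e) = 1 := by
  have := FIe_of (P := P) ⟨v, hv⟩
  simp only at this
  rw [this, Finsupp.sum_single_index rfl]

theorem FIStep.lt {P : Polyomino} {m m' : PVertex P →₀ ℕ} (h : FIStep P m m') :
    pmonLT P m' m := by
  obtain ⟨x1, x2, y1, y2, s, hi, rfl, rfl⟩ := h
  obtain ⟨ha, hb, hc, hd⟩ := hi.corners
  have h1 := hi.1
  have h2 := hi.2.1
  right
  constructor
  · simp only [FIdeg, FIdeg_e ha, FIdeg_e hb, FIdeg_e hc, FIdeg_e hd]
  · refine ⟨⟨(x1, y1), ha⟩, ?_, ?_⟩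
    · simp only [Finsupp.add_apply, FIe_apply, Prod.mk.injEq]
      split_ifs <;> omega
    · rintro ⟨⟨w1, w2⟩, hw⟩ hlt
      simp only [Finsupp.add_apply, FIe_apply, Prod.mk.injEq]
      simp only [varlt] at hlt
      split_ifs <;> omega

theorem FIreach_le {P : Polyomino} {m m' : PVertex P →₀ ℕ}
    (h : Relation.ReflTransGen (FIStep P) m m') : m' = m ∨ pmonLT P m' m := by
  induction h with
  | refl => exact Or.inl rfl
  | tail _ h ih =>
    right
    rcases ih with rfl | ih
    · exact h.lt
    · exact FIlt_trans h.lt ih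

/-! ### Termination measure -/

/-- Weight of a monomial. -/
noncomputable def FIwt (P : Polyomino) (n : ℤ) : (PVertex P →₀ ℕ) →ₗ[ℕ] ℕ :=
  Finsupp.linearCombination ℕ (fun v : PVertex P => (v.1.1 * (n - v.1.2)).toNat)

theorem FIwt_e {P : Polyomino} {n : ℤ} {v : ℤ × ℤ} (hv : v ∈ P.vertexSet) :
    FIwt P n (FIe P v) = (v.1 * (n - v.2)).toNat := by
  have := FIe_of (P := P) ⟨v, hv⟩
  simp only at this
  rw [this, FIwt, Finsupp.linearCombination_single]
  simp

theorem FIStep.wt {P : Polyomino} {n : ℤ} (hb : ∀ v ∈ P.vertexSet, 0 ≤ v.1 ∧ v.2 ≤ n)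
    {m m' : PVertex P →₀ ℕ} (h : FIStep P m m') : FIwt P n m' < FIwt P n m := by
  obtain ⟨x1, x2, y1, y2, s, hi, rfl, rfl⟩ := h
  obtain ⟨ha, hb', hc, hd⟩ := hi.corners
  have h1 := hi.1
  have h2 := hi.2.1
  have nn : ∀ v ∈ P.vertexSet, 0 ≤ v.1 * (n - v.2) := fun v hv =>
    mul_nonneg (hb v hv).1 (by have := (hb v hv).2; omega)
  simp only [map_add, FIwt_e ha, FIwt_e hb', FIwt_e hc, FIwt_e hd]
  have e1 := Int.toNat_of_nonneg (nn _ ha)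
  have e2 := Int.toNat_of_nonneg (nn _ hb')
  have e3 := Int.toNat_of_nonneg (nn _ hc)
  have e4 := Int.toNat_of_nonneg (nn _ hd)
  simp only at e1 e2 e3 e4
  have : 0 < (x2 - x1) * (y2 - y1) := mul_pos (by omega) (by omega)
  zify
  rw [e1, e2, e3, e4]
  nlinarith

/-! ### The main algebraic argument -/

theorem FImono {P : Polyomino} {K : Type} [Field K] (a b : PVertex P) :
    (MvPolynomial.X a * MvPolynomial.X b : PolyRing K P) =
      MvPolynomial.monomial (FIe P a.1 + FIe P b.1) 1 := by
  rw [FIe_of, FIe_of, MvPolynomial.X, MvPolynomial.X, MvPolynomial.monomial_mul, one_mul]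

theorem FImain (K : Type) [Field K] (P : Polyomino) (hG : FIGood P) (n : ℤ)
    (hb : ∀ v ∈ P.vertexSet, 0 ≤ v.1 ∧ v.2 ≤ n) :
    inIdeal K P = Ideal.span
      { g : PolyRing K P | ∃ a b c d : PVertex P,
          IsInnerInterval P a.1 b.1 ∧ c.1 = (a.1.1, b.1.2) ∧ d.1 = (b.1.1, a.1.2) ∧
          g = MvPolynomial.X c * MvPolynomial.X d } := by
  classical
  obtain ⟨N, hN1, hN2, hN3⟩ := FInewman (FIStep P) (FIwt P n) (fun a b h => h.wt hb)
    (fun m a b h1 h2 => FIlocal hG h1 h2)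
  apply le_antisymm
  · apply Ideal.span_le.2
    rintro g ⟨f, hf, -, m, ⟨hm, hlead⟩, rfl⟩
    by_cases hred : ∃ m', FIStep P m m'
    · obtain ⟨m', x1, x2, y1, y2, s, hi, rfl, -⟩ := hred
      obtain ⟨ha, hb', hc, hd⟩ := hi.corners
      have := Ideal.mul_mem_right (MvPolynomial.monomial s (1 : K)) (Ideal.span
        { g : PolyRing K P | ∃ a b c d : PVertex P,
          IsInnerInterval P a.1 b.1 ∧ c.1 = (a.1.1, b.1.2) ∧ d.1 = (b.1.1, a.1.2) ∧
          g = MvPolynomial.X c * MvPolynomial.X d })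
        (Ideal.subset_span ⟨⟨_, ha⟩, ⟨_, hb'⟩, ⟨_, hc⟩, ⟨_, hd⟩, (FIInn_iff _ _).2 hi, rfl, rfl,
          rfl⟩)
      rw [FImono, MvPolynomial.monomial_mul, one_mul] at this
      exact this
    · exfalso
      have hNm : N m = m := hN3 m (fun b hb => hred ⟨b, hb⟩)
      let φ : PolyRing K P →ₗ[K] K := (MvPolynomial.basisMonomials (PVertex P) K).constr K
        (fun m' => if N m' = m then (1 : K) else 0)
      have hφ : ∀ s k, φ (MvPolynomial.monomial s k) = k * if N s = m then (1 : K) else 0 := by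
        intro s k
        have h1 : φ (MvPolynomial.monomial s 1) = if N s = m then (1 : K) else 0 := by
          have := (MvPolynomial.basisMonomials (PVertex P) K).constr_basis K
            (fun m' => if N m' = m then (1 : K) else 0) s
          rwa [MvPolynomial.coe_basisMonomials] at this
        have h2 : (MvPolynomial.monomial s k : PolyRing K P) = k • MvPolynomial.monomial s 1 := by
          rw [MvPolynomial.smul_monomial, smul_eq_mul, mul_one]
        rw [h2, map_smul, h1, smul_eq_mul]
      have hI : ∀ f ∈ polyIdeal K P, ∀ p, φ (p * f) = 0 := by
        intro f hf
        refine Submodule.span_induction (p := fun f _ => ∀ p, φ (p * f) = 0) ?_ ?_ ?_ ?_ hf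
        · rintro g ⟨a, b, c, d, hi, hc, hd, rfl⟩ p
          rw [FImono, FImono]
          induction p using MvPolynomial.induction_on' with
          | monomial u k =>
            rw [mul_sub, MvPolynomial.monomial_mul, MvPolynomial.monomial_mul, map_sub, hφ, hφ,
              hN2 (u + (FIe P c.1 + FIe P d.1)) (u + (FIe P a.1 + FIe P b.1)), sub_self]
            refine ⟨_, _, _, _, u, (FIInn_iff _ _).1 hi, ?_, ?_⟩
            · rw [hc, hd]; abel
            · abel
          | add p q hp hq => rw [add_mul, map_add, hp, hq, add_zero]
        · intro p; simp
        · intro x y _ _ hx hy p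
          rw [mul_add, map_add, hx, hy, add_zero]
        · intro r x _ hx p
          rw [smul_eq_mul, ← mul_assoc]; exact hx _
      have h0 : φ f = 0 := by simpa using hI f hf 1
      have h1 : φ f = MvPolynomial.coeff m f := by
        conv_lhs => rw [MvPolynomial.as_sum f]
        rw [map_sum, Finset.sum_eq_single m]
        · rw [hφ, if_pos hNm, mul_one]
        · intro m' hm' hne
          rw [hφ, if_neg, mul_zero]
          intro hNm'
          have hlt := hlead m' hm' hne
          rcases FIreach_le (hN1 m') with h | h
          · exact hne (h.symm.trans hNm')
          · rw [hNm'] at h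
            exact FIlt_irrefl (FIlt_trans h hlt)
        · intro h; exact absurd hm h
      exact MvPolynomial.mem_support_iff.1 hm (h1.symm.trans h0)
  · apply Ideal.span_le.2
    rintro g ⟨a, b, c, d, hi, hc, hd, rfl⟩
    have hst : FIStep P (FIe P c.1 + FIe P d.1) (FIe P a.1 + FIe P b.1) :=
      ⟨_, _, _, _, 0, (FIInn_iff _ _).1 hi, by rw [hc, hd, add_zero], by rw [add_zero]⟩
    have hlt := hst.lt
    have hne : FIe P a.1 + FIe P b.1 ≠ FIe P c.1 + FIe P d.1 := by
      intro h; rw [h] at hlt; exact FIlt_irrefl hlt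
    have hco : MvPolynomial.coeff (FIe P c.1 + FIe P d.1)
        (MvPolynomial.X a * MvPolynomial.X b - MvPolynomial.X c * MvPolynomial.X d :
          PolyRing K P) ≠ 0 := by
      rw [FImono, FImono, MvPolynomial.coeff_sub, MvPolynomial.coeff_monomial,
        MvPolynomial.coeff_monomial, if_neg hne, if_pos rfl]
      simp
    refine Ideal.subset_span ⟨_, Ideal.subset_span ⟨a, b, c, d, hi, hc, hd, rfl⟩, ?_,
      FIe P c.1 + FIe P d.1, ⟨?_, ?_⟩, FImono c d⟩
    · intro h
      rw [h] at hco
      exact hco (MvPolynomial.coeff_zero _)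
    · exact MvPolynomial.mem_support_iff.2 hco
    · intro m' hm' hne'
      rw [MvPolynomial.mem_support_iff, FImono, FImono, MvPolynomial.coeff_sub,
        MvPolynomial.coeff_monomial, MvPolynomial.coeff_monomial, if_neg hne'.symm,
        sub_zero] at hm'
      have : FIe P a.1 + FIe P b.1 = m' := by
        by_contra h; exact hm' (if_neg h)
      rw [← this]; exact hlt

/-! ### North-east paths -/

theorem FIstep_path {L : List (ℤ × ℤ)} (hL : IsNEPath L) (i : ℕ) (hi : i + 1 < L.length) :
    L.getD (i + 1) 0 = ((L.getD i 0).1 + 1, (L.getD i 0).2) ∨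
      L.getD (i + 1) 0 = ((L.getD i 0).1, (L.getD i 0).2 + 1) := by
  have h := List.isChain_iff_getElem.1 hL.2 i hi
  rw [List.getD_eq_getElem _ _ hi, List.getD_eq_getElem _ _ (Nat.lt_of_succ_lt hi)]
  exact h

theorem FImono_path {L : List (ℤ × ℤ)} (hL : IsNEPath L) (i j : ℕ) (hij : i ≤ j)
    (hj : j < L.length) :
    (L.getD i 0).1 ≤ (L.getD j 0).1 ∧ (L.getD i 0).2 ≤ (L.getD j 0).2 := by
  induction j, hij using Nat.le_induction with
  | base => exact ⟨le_rfl, le_rfl⟩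
  | succ j hj' ih =>
    have := ih (by omega)
    rcases FIstep_path hL j hj with h | h <;> rw [h] <;> constructor <;> simp only <;> omega

theorem FIeast {L : List (ℤ × ℤ)} {x h : ℤ} :
    eastStepOf L x h ↔ ∃ i, i + 1 < L.length ∧ L.getD i 0 = (x, h) ∧
      L.getD (i + 1) 0 = (x + 1, h) := by
  unfold eastStepOf
  rw [List.mem_iff_getElem]
  constructor
  · rintro ⟨i, hi, he⟩
    simp only [List.length_zip, List.length_tail] at hi
    have h1 : i < L.length := by omega
    have h2 : i + 1 < L.length := by omega
    simp only [List.getElem_zip, List.getElem_tail, Prod.mk.injEq] at he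
    refine ⟨i, h2, ?_, ?_⟩
    · rw [List.getD_eq_getElem _ _ h1]; exact he.1
    · rw [List.getD_eq_getElem _ _ h2]; exact he.2
  · rintro ⟨i, h2, e1, e2⟩
    have h1 : i < L.length := by omega
    rw [List.getD_eq_getElem _ _ h1] at e1
    rw [List.getD_eq_getElem _ _ h2] at e2
    refine ⟨i, by simp only [List.length_zip, List.length_tail]; omega, ?_⟩
    simp only [List.getElem_zip, List.getElem_tail, e1, e2]

theorem FIinterior {L : List (ℤ × ℤ)} (i : ℕ) (h0 : 0 < i) (h1 : i + 1 < L.length) :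
    L.getD i 0 ∈ interiorPts L := by
  have h : i < L.length := by omega
  rw [List.getD_eq_getElem _ _ h]
  unfold interiorPts
  rw [List.mem_iff_getElem]
  refine ⟨i - 1, by simp only [List.length_dropLast, List.length_drop]; omega, ?_⟩
  simp only [List.getElem_dropLast, List.getElem_drop]
  congr 1
  omega

theorem FIeast_mono {L : List (ℤ × ℤ)} (hL : IsNEPath L) {x x' h h' : ℤ} (hx : x ≤ x')
    (h1 : eastStepOf L x h) (h2 : eastStepOf L x' h') : h ≤ h' := by
  obtain ⟨i, hi, e1, e2⟩ := FIeast.1 h1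
  obtain ⟨j, hj, e3, e4⟩ := FIeast.1 h2
  by_cases hij : i ≤ j
  · have := (FImono_path hL i j hij (by omega)).2
    rw [e1, e3] at this; exact this
  · have := (FImono_path hL (j + 1) i (by omega) (by omega)).1
    rw [e4, e1] at this
    simp only at this
    omega

theorem FIeast_ex {L : List (ℤ × ℤ)} (hL : IsNEPath L) {x x' u h h' : ℤ} (hx : x ≤ u)
    (hx' : u ≤ x') (h1 : eastStepOf L x h) (h2 : eastStepOf L x' h') :
    ∃ g, eastStepOf L u g := by
  classical
  obtain ⟨i, hi, e1, e2⟩ := FIeast.1 h1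
  obtain ⟨j, hj, e3, e4⟩ := FIeast.1 h2
  have hex : ∃ k, i ≤ k ∧ k < L.length ∧ u + 1 ≤ (L.getD k 0).1 := by
    by_cases hij : i ≤ j + 1
    · exact ⟨j + 1, hij, hj, by rw [e4]; simp only; omega⟩
    · have := (FImono_path hL (j + 1) i (by omega) (by omega)).1
      rw [e4, e1] at this
      simp only at this
      omega
  obtain ⟨k1, k2, k3⟩ := Nat.find_spec hex
  have hmin := fun t => @Nat.find_min _ _ hex t
  generalize Nat.find hex = k at *
  have hki : k ≠ i := by
    rintro rfl
    rw [e1] at k3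
    simp only at k3
    omega
  have hlt := hmin (k - 1) (by omega)
  have hlt' : (L.getD (k - 1) 0).1 ≤ u := by
    by_contra hcon
    exact hlt ⟨by omega, by omega, by omega⟩
  have hs := FIstep_path hL (k - 1) (by omega)
  have hk : k - 1 + 1 = k := by omega
  rw [hk] at hs
  rcases hs with hs | hs
  · refine ⟨(L.getD (k - 1) 0).2, FIeast.2 ⟨k - 1, by omega, ?_, ?_⟩⟩
    · rw [hs] at k3
      simp only at k3
      exact Prod.ext (by simp only; omega) rfl
    · rw [hk, hs]
      rw [hs] at k3
      simp only at k3
      exact Prod.ext (by simp only; omega) rfl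
  · rw [hs] at k3
    simp only at k3
    omega

theorem FIstrict {S1 S2 : List (ℤ × ℤ)} (hp : ParallelogramOn S1 S2) {p h1 h1' h2 h2' : ℤ}
    (a1 : eastStepOf S1 (p - 1) h1) (a2 : eastStepOf S1 p h1')
    (b1 : eastStepOf S2 (p - 1) h2') (b2 : eastStepOf S2 p h2) : h2 < h1 := by
  obtain ⟨i, hi, e1, e2⟩ := FIeast.1 a1
  obtain ⟨j, hj, e3, e4⟩ := FIeast.1 a2
  obtain ⟨i', hi', e1', e2'⟩ := FIeast.1 b1
  obtain ⟨j', hj', e3', e4'⟩ := FIeast.1 b2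
  have hij : i < j := by
    by_contra hcon
    have := (FImono_path hp.ne1 j i (by omega) (by omega)).1
    rw [e3, e1] at this
    simp only at this
    omega
  have hij' : i' < j' := by
    by_contra hcon
    have := (FImono_path hp.ne2 j' i' (by omega) (by omega)).1
    rw [e3', e1'] at this
    simp only at this
    omega
  have m1 := FIinterior (L := S1) (i + 1) (by omega) (by omega)
  have m2 := FIinterior (L := S2) j' (by omega) (by omega)
  have := hp.above _ m1 _ m2
  rw [e2, e3'] at this
  simp only at this
  exact this (by omega)

theorem FIcross {S1 S2 : List (ℤ × ℤ)} (hp : ParallelogramOn S1 S2) {c1 c2 d1 d2 p q : ℤ}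
    (hc : (c1, c2) ∈ parCells S1 S2) (hd : (d1, d2) ∈ parCells S1 S2)
    (h1 : c1 < p) (h2 : p ≤ d1) (h3 : c2 < q) (h4 : q ≤ d2) :
    ∃ f1 f2, (f1, f2) ∈ parCells S1 S2 ∧ ((c1 ≤ f1 ∧ f1 < p ∧ q ≤ f2 ∧ f2 ≤ d2) ∨
      (p ≤ f1 ∧ f1 ≤ d1 ∧ c2 ≤ f2 ∧ f2 < q)) := by
  obtain ⟨⟨hc1, sc1, lc1⟩, ⟨hc2, sc2, lc2⟩⟩ := hc
  obtain ⟨⟨hd1, sd1, ld1⟩, ⟨hd2, sd2, ld2⟩⟩ := hd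
  simp only at *
  obtain ⟨g1, sg1⟩ := FIeast_ex hp.ne1 (u := p - 1) (by omega) (by omega) sc1 sd1
  obtain ⟨k1, sk1⟩ := FIeast_ex hp.ne1 (u := p) (by omega) (by omega) sc1 sd1
  obtain ⟨g2, sg2⟩ := FIeast_ex hp.ne2 (u := p - 1) (by omega) (by omega) sc2 sd2
  obtain ⟨k2, sk2⟩ := FIeast_ex hp.ne2 (u := p) (by omega) (by omega) sc2 sd2
  have hst := FIstrict hp sg1 sk1 sg2 sk2
  have m1 := FIeast_mono hp.ne2 (by omega) sg2 sd2
  have m2 := FIeast_mono hp.ne2 (by omega) sg2 sk2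
  have m3 := FIeast_mono hp.ne1 (by omega) sc1 sk1
  have m4 := FIeast_mono hp.ne1 (by omega) sg1 sk1
  by_cases hq : q < g1
  · exact ⟨p - 1, max q g2, ⟨⟨g1, sg1, by simp only; omega⟩, ⟨g2, sg2, by simp only; omega⟩⟩,
      Or.inl ⟨by omega, by omega, by omega, by omega⟩⟩
  · exact ⟨p, max c2 k2, ⟨⟨k1, sk1, by simp only; omega⟩, ⟨k2, sk2, by simp only; omega⟩⟩,
      Or.inr ⟨by omega, by omega, by omega, by omega⟩⟩

/-! ### Frames -/

theorem FIframe_cells {P : Polyomino} {D : FrameData} (hP : IsFrame P D) (x y : ℤ) :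
    (x, y) ∈ P.cells ↔ (1 ≤ x ∧ x + 1 ≤ D.m ∧ 1 ≤ y ∧ y + 1 ≤ D.n) ∧
      (x, y) ∉ parCells D.S1 D.S2 := by
  rw [← Finset.mem_coe, hP]; rfl

theorem FIframe_good {P : Polyomino} {D : FrameData} (hP : IsFrame P D) : FIGood P := by
  intro x1 x2 x3 y1 y2 y3 hi hj
  by_contra hcon
  rw [not_or] at hcon
  obtain ⟨hA, hB⟩ := hcon
  have i1 := hi.1
  have i2 := hi.2.1
  have j1 := hj.1
  have j2 := hj.2.1
  have hA' : ∃ x y, x2 ≤ x ∧ x < x3 ∧ y2 ≤ y ∧ y < y3 ∧ (x, y) ∉ P.cells := by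
    by_contra h
    push Not at h
    exact hA ⟨j1, i2, h⟩
  have hB' : ∃ x y, x1 ≤ x ∧ x < x2 ∧ y1 ≤ y ∧ y < y2 ∧ (x, y) ∉ P.cells := by
    by_contra h
    push Not at h
    exact hB ⟨i1, j2, h⟩
  obtain ⟨d1, d2, p1, p2, p3, p4, p5⟩ := hA'
  obtain ⟨c1, c2, q1, q2, q3, q4, q5⟩ := hB'
  have t1 := ((FIframe_cells hP _ _).1 (hj.2.2 d1 y1 p1 p2 le_rfl j2)).1
  have t2 := ((FIframe_cells hP _ _).1 (hi.2.2 x1 d2 le_rfl i1 p3 p4)).1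
  have t3 := ((FIframe_cells hP _ _).1 (hi.2.2 c1 y2 q1 q2 le_rfl i2)).1
  have t4 := ((FIframe_cells hP _ _).1 (hj.2.2 x2 c2 le_rfl j1 q3 q4)).1
  have hd : (d1, d2) ∈ parCells D.S1 D.S2 := by
    by_contra h
    exact p5 ((FIframe_cells hP _ _).2 ⟨⟨t1.1, t1.2.1, t2.2.2.1, t2.2.2.2⟩, h⟩)
  have hc : (c1, c2) ∈ parCells D.S1 D.S2 := by
    by_contra h
    exact q5 ((FIframe_cells hP _ _).2 ⟨⟨t3.1, t3.2.1, t4.2.2.1, t4.2.2.2⟩, h⟩)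
  obtain ⟨f1, f2, hf, hor⟩ := FIcross D.par hc hd q2 p1 q4 p3
  rcases hor with ⟨a1, a2, a3, a4⟩ | ⟨a1, a2, a3, a4⟩
  · exact ((FIframe_cells hP _ _).1 (hi.2.2 f1 f2 (by omega) a2 a3 (by omega))).2 hf
  · exact ((FIframe_cells hP _ _).1 (hj.2.2 f1 f2 a1 (by omega) (by omega) a4)).2 hf

theorem FIframe_bound {P : Polyomino} {D : FrameData} (hP : IsFrame P D) :
    ∀ v ∈ P.vertexSet, 0 ≤ v.1 ∧ v.2 ≤ D.n := by
  intro v hv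
  obtain ⟨c, hc, hv⟩ := Finset.mem_biUnion.1 hv
  have := ((FIframe_cells hP c.1 c.2).1 hc).1
  simp only [cellVertices, Finset.mem_insert, Finset.mem_singleton] at hv
  rcases hv with rfl | rfl | rfl | rfl <;> constructor <;> (try simp only) <;> omega

theorem frame_initial_ideal (K : Type) [Field K] (P : Polyomino)
    (D : FrameData) (hP : IsFrame P D) :
    inIdeal K P = Ideal.span
      { g : PolyRing K P | ∃ a b c d : PVertex P,
          IsInnerInterval P a.1 b.1 ∧ c.1 = (a.1.1, b.1.2) ∧ d.1 = (b.1.1, a.1.2) ∧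
          g = MvPolynomial.X c * MvPolynomial.X d } := by
  exact FImain K P (FIframe_good hP) D.n (FIframe_bound hP)
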